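/- Every measurable symmetric reflexive relation S on the set R of rays of T'_m is Borel, i.e., S is a Borel subset of R×R. -/

import Mathlib

open MeasureTheory

namespace RCTree

abbrev Edge (m : ℕ) := Fin (m + 1) × List (Fin m)
abbrev V (m : ℕ) := Option (Edge m)
abbrev Ray (m : ℕ) := Fin (m + 1) × (ℕ → Fin m)
abbrev Config (m : ℕ) := Edge m → Bool

variable {m : ℕ}

/-- The vertex at the top (towards the root) of an edge. -/
def parentV (e : Edge m) : V m :=
  if e.2 = [] then none else some (e.1, e.2.dropLast)

/-- The vertex at the bottom (away from the root) of an edge. -/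
def childV (e : Edge m) : V m := some e

/-- The (undirected) edge `e` has endvertices `u` and `v`. -/
def EndsAt (e : Edge m) (u v : V m) : Prop :=
  (parentV e = u ∧ childV e = v) ∨ (parentV e = v ∧ childV e = u)

/-- The `n`-th edge of a ray from the root. -/
def rayEdge (ρ : Ray m) (n : ℕ) : Edge m := (ρ.1, List.ofFn fun k : Fin n => ρ.2 k)

/-- The `n`-th vertex of a ray from the root. -/
def rayVtx (ρ : Ray m) : ℕ → V m
  | 0 => none
  | n + 1 => some (rayEdge ρ n)

def rayEdges (ρ : Ray m) : Set (Edge m) := Set.range (rayEdge ρ)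

/-- The ray `ρ` passes through the vertex `v`. -/
def RayThrough (ρ : Ray m) (v : V m) : Prop := ∃ n, rayVtx ρ n = v

/-- All edges of the ray `ρ` are open in `ω`. -/
def OpenRay (ω : Config m) (ρ : Ray m) : Prop := ∀ n, ω (rayEdge ρ n) = true

/-- An infinite self-avoiding (undirected) path with endpoint `x`. -/
structure IPath (m : ℕ) (x : V m) where
  vtx : ℕ → V m
  start : vtx 0 = x
  inj : Function.Injective vtx
  adj : ∀ n, ∃ e : Edge m, EndsAt e (vtx n) (vtx (n + 1))

/-- The edges traversed by an infinite path. -/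
def IPath.edges {x : V m} (π : IPath m x) : Set (Edge m) :=
  {e | ∃ n, EndsAt e (π.vtx n) (π.vtx (n + 1))}

/-- A path is forward (an `x`-ray) if it is directed away from the root. -/
def IPath.Forward {x : V m} (π : IPath m x) : Prop :=
  ∀ n, ∃ e : Edge m, parentV e = π.vtx n ∧ childV e = π.vtx (n + 1)

/-- All edges of the path `π` are open in `ω`. -/
def OpenPath {x : V m} (ω : Config m) (π : IPath m x) : Prop :=
  ∀ e ∈ π.edges, ω e = true

/-- The path `π` and the `0`-ray `ρ` differ in only finitely many edges:
`ρ` is the `0`-ray associated with `π`. -/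
def Assoc {x : V m} (π : IPath m x) (ρ : Ray m) : Prop :=
  ((IPath.edges π \ rayEdges ρ) ∪ (rayEdges ρ \ IPath.edges π)).Finite

/-- The set of edges with both endvertices in `Λ`. -/
def ELam (Λ : Set (V m)) : Set (Edge m) :=
  {e | parentV e ∈ Λ ∧ childV e ∈ Λ}

/-- The event `K^S_{u,v,Λ}`: there exist vertex-disjoint open infinite paths from `u` and
from `v`, edge-disjoint from `E_Λ`, whose associated `0`-rays are `S`-related. -/
def KEvent (S : Ray m → Ray m → Prop) (Λ : Set (V m)) (u v : V m) : Set (Config m) :=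
  {ω | ∃ (πu : IPath m u) (πv : IPath m v),
      (∀ a b, πu.vtx a ≠ πv.vtx b) ∧
      OpenPath ω πu ∧ OpenPath ω πv ∧
      (∀ e ∈ πu.edges, e ∉ ELam Λ) ∧ (∀ e ∈ πv.edges, e ∉ ELam Λ) ∧
      ∃ ρu ρv : Ray m, Assoc πu ρu ∧ Assoc πv ρv ∧ S ρu ρv}

/-- The event `A^S_{u,v}`: there exist open `u`- and `v`-rays whose associated
`0`-rays are `S`-related. -/
def AEvent (S : Ray m → Ray m → Prop) (u v : V m) : Set (Config m) :=
  {ω | ∃ (πu : IPath m u) (πv : IPath m v),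
      πu.Forward ∧ πv.Forward ∧ OpenPath ω πu ∧ OpenPath ω πv ∧
      ∃ ρu ρv : Ray m, Assoc πu ρu ∧ Assoc πv ρv ∧ S ρu ρv}

/-- The event `A'^S_{u,v}`: there exist open `0`-rays through `u` and through `v`
that are `S`-related. -/
def APrimeEvent (S : Ray m → Ray m → Prop) (u v : V m) : Set (Config m) :=
  {ω | ∃ ρu ρv : Ray m, RayThrough ρu u ∧ RayThrough ρv v ∧
      OpenRay ω ρu ∧ OpenRay ω ρv ∧ S ρu ρv}

/-- `u` lies on the (unique) path of the tree from the root to `v` (ancestor-or-equal). -/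
def Anc : V m → V m → Prop
  | none, _ => True
  | some _, none => False
  | some e, some f => e.1 = f.1 ∧ e.2 <+: f.2

/-- Two vertices are comparable if one lies on the path from the root to the other. -/
def Comparable (u v : V m) : Prop := Anc u v ∨ Anc v u

/-- `W` is a cutset: it is incomparable (no ray contains more than one member of `W`)
and every ray contains some member of `W`. -/
def IsCutset (W : Set (V m)) : Prop :=
  (∀ (ρ : Ray m) (u v : V m), u ∈ W → v ∈ W → RayThrough ρ u → RayThrough ρ v → u = v) ∧
  ∀ ρ : Ray m, ∃ v ∈ W, RayThrough ρ v

/-- The distance of a vertex from the root. -/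
def depth : V m → ℕ
  | none => 0
  | some e => e.2.length + 1

theorem depth_parentV (e : Edge m) : depth (parentV e) + 1 = depth (childV e) := by
  obtain ⟨i, l⟩ := e
  rcases l with _ | ⟨a, l⟩ <;> simp [parentV, childV, depth]

theorem depth_rayVtx (ρ : Ray m) (n : ℕ) : depth (rayVtx ρ n) = n := by
  cases n <;> simp [rayVtx, depth, rayEdge]

theorem rayVtx_injective (ρ : Ray m) : Function.Injective (rayVtx ρ) := fun a b h => by
  simpa [depth_rayVtx] using congrArg depth h

theorem childV_rayEdge (ρ : Ray m) (n : ℕ) : childV (rayEdge ρ n) = rayVtx ρ (n + 1) := rfl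

theorem parentV_rayEdge (ρ : Ray m) (n : ℕ) : parentV (rayEdge ρ n) = rayVtx ρ n := by
  cases n with
  | zero => simp [parentV, rayEdge, rayVtx]
  | succ n =>
    have h : (List.ofFn fun k : Fin (n + 1) => ρ.2 k)
        = (List.ofFn fun k : Fin n => ρ.2 k) ++ [ρ.2 n] := by
      rw [List.ofFn_succ_last]; simp
    have hne : (rayEdge ρ (n + 1)).2 ≠ [] := by simp [rayEdge]
    have hd : (rayEdge ρ (n + 1)).2.dropLast = (rayEdge ρ n).2 := by
      unfold rayEdge
      rw [h, List.dropLast_concat]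
    rw [parentV, if_neg hne, hd]
    rfl

theorem rayVtx_eq_of_succ {ρ₁ ρ₂ : Ray m} {n : ℕ} (h : rayVtx ρ₁ (n + 1) = rayVtx ρ₂ (n + 1)) :
    rayVtx ρ₁ n = rayVtx ρ₂ n := by
  have h' : rayEdge ρ₁ n = rayEdge ρ₂ n := by simpa [rayVtx] using h
  rw [← parentV_rayEdge, ← parentV_rayEdge, h']

theorem rayVtx_eq_of_le {ρ₁ ρ₂ : Ray m} {a b : ℕ} (hab : a ≤ b)
    (h : rayVtx ρ₁ b = rayVtx ρ₂ b) : rayVtx ρ₁ a = rayVtx ρ₂ a := by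
  induction b, hab using Nat.le_induction with
  | base => exact h
  | succ b _ ih => exact ih (rayVtx_eq_of_succ h)

theorem ray_eq_of_rayVtx {ρ₁ ρ₂ : Ray m} (h : ∀ n, rayVtx ρ₁ n = rayVtx ρ₂ n) : ρ₁ = ρ₂ := by
  have h' : ∀ n, rayEdge ρ₁ n = rayEdge ρ₂ n := fun n => by
    simpa [rayVtx] using h (n + 1)
  have h₀ : ρ₁.1 = ρ₂.1 := congrArg (fun e : Edge m => e.1) (h' 0)
  refine Prod.ext h₀ (funext fun k => ?_)
  have hk := List.ofFn_injective (congrArg (fun e : Edge m => e.2) (h' (k + 1)))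
  exact congrFun hk (Fin.last k)

/-- The part of a ray after its first `N` edges. -/
def tailPath (ρ : Ray m) (N : ℕ) : IPath m (rayVtx ρ N) where
  vtx k := rayVtx ρ (N + k)
  start := rfl
  inj _ _ h := Nat.add_left_cancel (rayVtx_injective ρ h)
  adj k := ⟨rayEdge ρ (N + k), Or.inl ⟨parentV_rayEdge _ _, childV_rayEdge _ _⟩⟩

theorem endsAt_rayVtx {ρ : Ray m} {n : ℕ} {e : Edge m}
    (h : EndsAt e (rayVtx ρ n) (rayVtx ρ (n + 1))) : e = rayEdge ρ n := by
  rcases h with ⟨_, h⟩ | ⟨h₁, h₂⟩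
  · simpa [childV, rayVtx] using h
  · have := depth_parentV e
    rw [h₁, h₂, depth_rayVtx, depth_rayVtx] at this
    omega

theorem edges_eq_of_vtx {x : V m} (π : IPath m x) {ρ : Ray m} {N : ℕ}
    (h : ∀ k, π.vtx k = rayVtx ρ (N + k)) : π.edges = rayEdge ρ '' Set.Ici N := by
  ext e
  constructor
  · rintro ⟨k, hk⟩
    rw [h, h] at hk
    exact ⟨N + k, Nat.le_add_right N k, (endsAt_rayVtx hk).symm⟩
  · rintro ⟨j, hj, rfl⟩
    obtain ⟨k, rfl⟩ := Nat.exists_eq_add_of_le (Set.mem_Ici.1 hj)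
    refine ⟨k, Or.inl ⟨?_, ?_⟩⟩
    · rw [h, parentV_rayEdge]
    · rw [h, childV_rayEdge, Nat.add_assoc]

theorem assoc_of_vtx {x : V m} (π : IPath m x) {ρ : Ray m} {N : ℕ}
    (h : ∀ k, π.vtx k = rayVtx ρ (N + k)) : Assoc π ρ := by
  refine ((Set.finite_Iio N).image (rayEdge ρ)).subset ?_
  rw [edges_eq_of_vtx π h]
  rintro e (⟨⟨j, -, rfl⟩, he⟩ | ⟨⟨j, rfl⟩, he⟩)
  · exact (he ⟨j, rfl⟩).elim
  · exact ⟨j, Set.mem_Iio.2 (not_le.1 fun hj => he ⟨j, hj, rfl⟩), rfl⟩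

theorem eq_of_assoc_of_vtx {x : V m} (π : IPath m x) {ρ ρ' : Ray m} {N : ℕ}
    (h : ∀ k, π.vtx k = rayVtx ρ (N + k)) (hρ' : Assoc π ρ') : ρ' = ρ := by
  refine ray_eq_of_rayVtx fun n => ?_
  have hinj : Function.Injective (rayEdge ρ') := fun a b hab =>
    Nat.succ_injective (rayVtx_injective ρ' (congrArg some hab))
  have hfin : {j | rayEdge ρ' j ∉ π.edges}.Finite := by
    refine Set.Finite.subset (hρ'.preimage hinj.injOn) fun j hj => Or.inr ⟨⟨j, rfl⟩, hj⟩
  obtain ⟨j, hj, hnj⟩ := hfin.infinite_compl.exists_gt n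
  have hj' : rayEdge ρ' j ∈ π.edges := not_not.1 hj
  rw [edges_eq_of_vtx π h] at hj'
  obtain ⟨i, -, hi⟩ := hj'
  have hv : rayVtx ρ (i + 1) = rayVtx ρ' (j + 1) := congrArg some hi
  have hij : i + 1 = j + 1 := by simpa [depth_rayVtx] using congrArg depth hv
  rw [hij] at hv
  exact rayVtx_eq_of_le (by omega) hv.symm

open Classical in
/-- The configuration whose open edges are those of `ρ₁` and `ρ₂` after the first `N`. -/
noncomputable def tailConfig (N : ℕ) (x : Ray m × Ray m) : Config m := fun e =>
  decide (∃ j, N ≤ j ∧ (rayEdge x.1 j = e ∨ rayEdge x.2 j = e))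

theorem tailConfig_swap (N : ℕ) (x : Ray m × Ray m) : tailConfig N x.swap = tailConfig N x := by
  funext e
  simp [tailConfig, or_comm]

theorem vtx_of_openPath_tailConfig {x : Ray m × Ray m} {N : ℕ}
    (hne : rayVtx x.1 N ≠ rayVtx x.2 N) {u : V m} (hu : rayVtx x.1 N = u) (π : IPath m u)
    (hπ : OpenPath (tailConfig N x) π) (k : ℕ) : π.vtx k = rayVtx x.1 (N + k) := by
  induction k using Nat.strong_induction_on with
  | _ k ih =>
  rcases k with _ | k
  · rw [π.start, ← hu, Nat.add_zero]
  have hk := ih k k.lt_succ_self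
  obtain ⟨e, he⟩ := π.adj k
  obtain ⟨j, hj, hje⟩ : ∃ j, N ≤ j ∧ (rayEdge x.1 j = e ∨ rayEdge x.2 j = e) := by
    simpa [tailConfig] using hπ e ⟨k, he⟩
  have hparent : parentV e = rayVtx x.1 j ∨ parentV e = rayVtx x.2 j := by
    rcases hje with rfl | rfl <;> simp [parentV_rayEdge]
  have hchild : childV e = rayVtx x.1 (j + 1) ∨ childV e = rayVtx x.2 (j + 1) := by
    rcases hje with rfl | rfl <;> simp [childV_rayEdge]
  have hdp : depth (parentV e) = j := by
    rcases hparent with h | h <;> rw [h, depth_rayVtx]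
  have hdc := depth_parentV e
  rcases he with ⟨hp, hc⟩ | ⟨hp, hc⟩
  · rw [hk] at hp
    have hjk : N + k = j := by rw [hp, depth_rayVtx] at hdp; exact hdp
    subst hjk
    rcases hje with rfl | rfl
    · exact hc.symm
    · rw [parentV_rayEdge] at hp
      exact (hne (rayVtx_eq_of_le hj hp.symm)).elim
  · rw [hk] at hc
    have hjk : N + k = j + 1 := by rw [hc, depth_rayVtx, hdp] at hdc; exact hdc.symm
    obtain ⟨k, rfl⟩ : ∃ l, k = l + 1 := ⟨k - 1, by omega⟩
    obtain rfl : j = N + k := by omega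
    have hprev := ih k (by omega)
    rcases hje with rfl | rfl
    · rw [parentV_rayEdge, ← hprev] at hp
      have := π.inj hp
      omega
    · rw [childV_rayEdge] at hc
      exact (hne (rayVtx_eq_of_le (by omega) hc.symm)).elim

theorem tailConfig_mem_KEvent_iff (S : Ray m → Ray m → Prop) {x : Ray m × Ray m} {N : ℕ}
    (hne : rayVtx x.1 N ≠ rayVtx x.2 N) :
    tailConfig N x ∈ KEvent S {rayVtx x.1 N, rayVtx x.2 N} (rayVtx x.1 N) (rayVtx x.2 N) ↔
      S x.1 x.2 := by
  constructor
  · rintro ⟨πu, πv, -, hou, hov, -, -, ρu, ρv, hau, hav, hS⟩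
    have hu := vtx_of_openPath_tailConfig hne rfl πu hou
    have hv := vtx_of_openPath_tailConfig (x := x.swap) hne.symm rfl πv
      (by rw [tailConfig_swap]; exact hov)
    rw [eq_of_assoc_of_vtx πu hu hau, eq_of_assoc_of_vtx πv hv hav] at hS
    exact hS
  · intro hS
    have hE : ∀ ρ : Ray m, ∀ e ∈ (tailPath ρ N).edges,
        e ∉ ELam {rayVtx x.1 N, rayVtx x.2 N} := by
      intro ρ e he heΛ
      rw [edges_eq_of_vtx (tailPath ρ N) (fun _ => rfl)] at he
      obtain ⟨j, hj, rfl⟩ := he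
      have hd := depth_rayVtx ρ (j + 1)
      have hj : N ≤ j := hj
      rcases heΛ.2 with h | h <;> rw [childV_rayEdge] at h <;>
        rw [h, depth_rayVtx] at hd <;> omega
    refine ⟨tailPath x.1 N, tailPath x.2 N, fun a b h => ?_, fun e he => ?_, fun e he => ?_,
      hE _, hE _, x.1, x.2, assoc_of_vtx _ fun _ => rfl, assoc_of_vtx _ fun _ => rfl, hS⟩
    · have h : rayVtx x.1 (N + a) = rayVtx x.2 (N + b) := h
      have hab := congrArg depth h
      rw [depth_rayVtx, depth_rayVtx] at hab
      rw [hab] at h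
      exact hne (rayVtx_eq_of_le (by omega) h)
    · rw [edges_eq_of_vtx (tailPath x.1 N) (fun _ => rfl)] at he
      obtain ⟨j, hj, rfl⟩ := he
      simp only [tailConfig, decide_eq_true_eq]
      exact ⟨j, hj, Or.inl rfl⟩
    · rw [edges_eq_of_vtx (tailPath x.2 N) (fun _ => rfl)] at he
      obtain ⟨j, hj, rfl⟩ := he
      simp only [tailConfig, decide_eq_true_eq]
      exact ⟨j, hj, Or.inr rfl⟩

theorem measurableSet_rayEdge_eq (n : ℕ) (e : Edge m) :
    MeasurableSet {ρ : Ray m | rayEdge ρ n = e} := by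
  have h₁ : Measurable fun ρ : Ray m => (ρ.1, fun k : Fin n => ρ.2 k) := by fun_prop
  have h₂ : MeasurableSet {p : Fin (m + 1) × (Fin n → Fin m) | (p.1, List.ofFn p.2) = e} :=
    (Set.toFinite _).measurableSet
  exact h₁ h₂

theorem measurableSet_rayVtx_eq (n : ℕ) (v : V m) :
    MeasurableSet {ρ : Ray m | rayVtx ρ n = v} := by
  rcases n with _ | n
  · exact MeasurableSet.const (none = v)
  · rcases v with _ | e
    · simp [rayVtx]
    · simpa [rayVtx] using measurableSet_rayEdge_eq n e

theorem measurable_tailConfig (N : ℕ) : Measurable (tailConfig (m := m) N) := by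
  refine measurable_pi_lambda _ fun e => measurable_to_bool ?_
  have h : (fun x : Ray m × Ray m => tailConfig N x e) ⁻¹' {true} =
      ⋃ j, ⋃ _ : N ≤ j, (Prod.fst ⁻¹' {ρ : Ray m | rayEdge ρ j = e} ∪
        Prod.snd ⁻¹' {ρ : Ray m | rayEdge ρ j = e}) := by
    ext x
    simp [tailConfig]
  rw [h]
  exact MeasurableSet.iUnion fun j => MeasurableSet.iUnion fun _ =>
    (measurable_fst (measurableSet_rayEdge_eq j e)).union
      (measurable_snd (measurableSet_rayEdge_eq j e))

/-- Every measurable symmetric reflexive relation on the set of rays of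
`T'_m` is a Borel subset of `R × R`. -/
theorem measurable_rel_borel (m : ℕ) (hm : 2 ≤ m) (S : Ray m → Ray m → Prop)
    (hrefl : ∀ ρ, S ρ ρ) (hsymm : ∀ ρ₁ ρ₂, S ρ₁ ρ₂ → S ρ₂ ρ₁)
    (hmeas : ∀ Λ : Set (V m), Λ.Finite → ∀ u ∈ Λ, ∀ v ∈ Λ, MeasurableSet (KEvent S Λ u v)) :
    MeasurableSet[borel (Ray m × Ray m)] {x : Ray m × Ray m | S x.1 x.2} := by
  rw [← BorelSpace.measurable_eq (α := Ray m × Ray m)]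
  have hS : {x : Ray m × Ray m | S x.1 x.2} = Set.diagonal (Ray m) ∪
      ⋃ (N : ℕ) (u : V m) (v : V m) (_ : u ≠ v),
        (Prod.fst ⁻¹' {ρ : Ray m | rayVtx ρ N = u} ∩ Prod.snd ⁻¹' {ρ : Ray m | rayVtx ρ N = v}) ∩
          tailConfig N ⁻¹' KEvent S {u, v} u v := by
    ext x
    simp only [Set.mem_union, Set.mem_iUnion, Set.mem_diagonal_iff, Set.mem_inter_iff,
      Set.mem_preimage, Set.mem_ofPred_eq]
    constructor
    · intro hx
      by_cases heq : x.1 = x.2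
      · exact Or.inl heq
      · obtain ⟨N, hN⟩ := not_forall.1 fun h => heq (ray_eq_of_rayVtx h)
        exact Or.inr ⟨N, _, _, hN, ⟨rfl, rfl⟩, (tailConfig_mem_KEvent_iff S hN).2 hx⟩
    · rintro (heq | ⟨N, u, v, hne, ⟨rfl, rfl⟩, hK⟩)
      · rw [heq]
        exact hrefl _
      · exact (tailConfig_mem_KEvent_iff S hne).1 hK
  rw [hS]
  refine measurableSet_diagonal.union (MeasurableSet.iUnion fun N => MeasurableSet.iUnion fun u =>
    MeasurableSet.iUnion fun v => MeasurableSet.iUnion fun _ => ?_)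
  exact ((measurable_fst (measurableSet_rayVtx_eq N u)).inter
    (measurable_snd (measurableSet_rayVtx_eq N v))).inter
      (measurable_tailConfig N (hmeas {u, v} (Set.toFinite _) u (by simp) v (by simp)))

end RCTree
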